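/- For every smooth ℂ-valued function ψ on Ω, the rescaled Teukolsky operator satisfies the identity 𝐓_s ψ = −4(r²+a²)·e₃(e₄ψ) + 𝒰(𝒰ψ) + (1/sinθ)∂_θ(sinθ·∂_θψ) − 4ias·cosθ·Tψ + 2is·(a²sinθcosθ/(r²+a²))·𝒰ψ + 2r·(e₄ψ − μ·e₃ψ) + 4s·[(r−M)·e₃ψ − r·Tψ] + (2ar/(r²+a²))·Φψ − s·ψ − s²·(a⁴sin²θcos²θ/(r²+a²)²)·ψ at every point of Ω. -/

import Mathlib

noncomputable section

/-- `ℂ`-valued functions of the Boyer–Lindquist coordinates `(t, r, θ, φ)`. -/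
abbrev KF : Type := ℝ → ℝ → ℝ → ℝ → ℂ

/-- Partial derivative in `t` (the operator `T`). -/
def pt (ψ : KF) : KF := fun t r θ φ => deriv (fun t' => ψ t' r θ φ) t
/-- Partial derivative in `r`. -/
def pr (ψ : KF) : KF := fun t r θ φ => deriv (fun r' => ψ t r' θ φ) r
/-- Partial derivative in `θ`. -/
def pth (ψ : KF) : KF := fun t r θ φ => deriv (fun θ' => ψ t r θ' φ) θ
/-- Partial derivative in `φ` (the operator `Φ`). -/
def pph (ψ : KF) : KF := fun t r θ φ => deriv (fun φ' => ψ t r θ φ') φ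

/-- `Δ(r) = r² − 2Mr + a²`. -/
def Δk (M a r : ℝ) : ℝ := r^2 - 2*M*r + a^2

/-- The null vector field `e₃`. -/
def e3 (M a : ℝ) (ψ : KF) : KF := fun t r θ φ =>
  (1/2 : ℂ) * (-(pr ψ t r θ φ)
    + (((r^2 + a^2)/Δk M a r : ℝ) : ℂ) * pt ψ t r θ φ
    + ((a/Δk M a r : ℝ) : ℂ) * pph ψ t r θ φ)

/-- The null vector field `e₄`. -/
def e4 (M a : ℝ) (ψ : KF) : KF := fun t r θ φ =>
  (1/2 : ℂ) * (((Δk M a r/(r^2 + a^2) : ℝ) : ℂ) * pr ψ t r θ φ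
    + pt ψ t r θ φ
    + ((a/(r^2 + a^2) : ℝ) : ℂ) * pph ψ t r θ φ)

/-- The spin-weighted operator `𝒰`. -/
def Uop (M a : ℝ) (s : ℤ) (ψ : KF) : KF := fun t r θ φ =>
  ((1/Real.sin θ : ℝ) : ℂ) * pph ψ t r θ φ
  + ((a * Real.sin θ : ℝ) : ℂ) * pt ψ t r θ φ
  + Complex.I * (s : ℂ) *
      (((Real.cos θ/Real.sin θ) * ((r^2 + a^2 * (Real.cos θ)^2)/(r^2 + a^2)) : ℝ) : ℂ) *
      ψ t r θ φ

/-- The Teukolsky operator `𝐓̂_s`. -/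
def TeukHat (M a : ℝ) (s : ℤ) (ψ : KF) : KF := fun t r θ φ =>
  -((((r^2 + a^2)^2/Δk M a r - a^2 * (Real.sin θ)^2 : ℝ)) : ℂ) * pt (pt ψ) t r θ φ
  - ((4*M*a*r/Δk M a r : ℝ) : ℂ) * pt (pph ψ) t r θ φ
  - ((a^2/Δk M a r - 1/(Real.sin θ)^2 : ℝ) : ℂ) * pph (pph ψ) t r θ φ
  + ((Δk M a r ^ (-s) : ℝ) : ℂ) *
      pr (fun t' r' θ' φ' => ((Δk M a r' ^ (s+1) : ℝ) : ℂ) * pr ψ t' r' θ' φ') t r θ φ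
  + ((1/Real.sin θ : ℝ) : ℂ) *
      pth (fun t' r' θ' φ' => ((Real.sin θ' : ℝ) : ℂ) * pth ψ t' r' θ' φ') t r θ φ
  + 2 * (s : ℂ) * (((a*(r - M)/Δk M a r : ℝ) : ℂ)
      + Complex.I * ((Real.cos θ/(Real.sin θ)^2 : ℝ) : ℂ)) * pph ψ t r θ φ
  + 2 * (s : ℂ) * (((M*(r^2 - a^2)/Δk M a r - r : ℝ) : ℂ)
      - Complex.I * ((a * Real.cos θ : ℝ) : ℂ)) * pt ψ t r θ φ
  - ((((s : ℝ)^2 * (Real.cos θ)^2/(Real.sin θ)^2 - (s : ℝ) : ℝ)) : ℂ) * ψ t r θ φ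

/-- The rescaled Teukolsky operator `𝐓_s = Δ^s 𝐓̂_s (Δ^{−s} ·)`. -/
def Teuk (M a : ℝ) (s : ℤ) (ψ : KF) : KF := fun t r θ φ =>
  ((Δk M a r ^ s : ℝ) : ℂ) *
    TeukHat M a s (fun t' r' θ' φ' => ((Δk M a r' ^ (-s) : ℝ) : ℂ) * ψ t' r' θ' φ') t r θ φ

/-- The open region `Ω = {r₋ < r < r₊, 0 < θ < π}` of the Kerr black hole interior,
in Boyer–Lindquist coordinates `(t, r, θ, φ)`. -/
def KerrΩ (M a : ℝ) : Set (ℝ × ℝ × ℝ × ℝ) :=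
  {p | M - Real.sqrt (M^2 - a^2) < p.2.1 ∧ p.2.1 < M + Real.sqrt (M^2 - a^2)
       ∧ 0 < p.2.2.1 ∧ p.2.2.1 < Real.pi}

/-- The second-order angular operator `ð_{s−1}ð'_s`. -/
def edthMinus (s : ℤ) (ψ : KF) : KF := fun t r θ φ =>
  ((1/Real.sin θ : ℝ) : ℂ) *
      pth (fun t' r' θ' φ' => ((Real.sin θ' : ℝ) : ℂ) * pth ψ t' r' θ' φ') t r θ φ
  + ((1/(Real.sin θ)^2 : ℝ) : ℂ) * pph (pph ψ) t r θ φ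
  + 2 * Complex.I * (s : ℂ) * ((Real.cos θ/(Real.sin θ)^2 : ℝ) : ℂ) * pph ψ t r θ φ
  - ((((s : ℝ)^2 * (Real.cos θ/Real.sin θ)^2 - (s : ℝ)) : ℝ) : ℂ) * ψ t r θ φ

/-- The second-order angular operator `ð'_{s+1}ð_s`. -/
def edthPlus (s : ℤ) (ψ : KF) : KF := fun t r θ φ =>
  ((1/Real.sin θ : ℝ) : ℂ) *
      pth (fun t' r' θ' φ' => ((Real.sin θ' : ℝ) : ℂ) * pth ψ t' r' θ' φ') t r θ φ
  + ((1/(Real.sin θ)^2 : ℝ) : ℂ) * pph (pph ψ) t r θ φ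
  + 2 * Complex.I * (s : ℂ) * ((Real.cos θ/(Real.sin θ)^2 : ℝ) : ℂ) * pph ψ t r θ φ
  - ((((s : ℝ)^2 * (Real.cos θ/Real.sin θ)^2 + (s : ℝ)) : ℝ) : ℂ) * ψ t r θ φ

/-- The spin-weighted Carter operator `𝒬_s`. -/
def Qop (a : ℝ) (s : ℤ) (ψ : KF) : KF := fun t r θ φ =>
  ((a^2 * (Real.sin θ)^2 : ℝ) : ℂ) * pt (pt ψ) t r θ φ
  - 2 * Complex.I * (a : ℂ) * (s : ℂ) * ((Real.cos θ : ℝ) : ℂ) * pt ψ t r θ φ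
  + ((1/Real.sin θ : ℝ) : ℂ) *
      pth (fun t' r' θ' φ' => ((Real.sin θ' : ℝ) : ℂ) * pth ψ t' r' θ' φ') t r θ φ
  + ((1/(Real.sin θ)^2 : ℝ) : ℂ) * pph (pph ψ) t r θ φ
  + 2 * Complex.I * (s : ℂ) * ((Real.cos θ/(Real.sin θ)^2 : ℝ) : ℂ) * pph ψ t r θ φ
  - ((((s : ℝ)^2 * (Real.cos θ/Real.sin θ)^2 + (s : ℝ)) : ℝ) : ℂ) * ψ t r θ φ

/-- A function of the four coordinates, read as a function on `ℝ × ℝ × ℝ × ℝ`. -/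
def KF.uncurried (ψ : KF) : ℝ × ℝ × ℝ × ℝ → ℂ := fun p => ψ p.1 p.2.1 p.2.2.1 p.2.2.2

/-- Smoothness on the Kerr black hole interior. -/
def KF.SmoothOn (M a : ℝ) (ψ : KF) : Prop :=
  ContDiffOn ℝ (⊤ : ℕ∞) ψ.uncurried (KerrΩ M a)

theorem isOpen_KerrΩ (M a : ℝ) : IsOpen (KerrΩ M a) := by
  unfold KerrΩ
  simp only [Set.ofPred_and]
  refine (isOpen_lt ?_ ?_).inter ((isOpen_lt ?_ ?_).inter ((isOpen_lt ?_ ?_).inter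
    (isOpen_lt ?_ ?_))) <;> fun_prop

theorem Δk_neg {M a r : ℝ} (haM : |a| < M) (h₁ : M - Real.sqrt (M^2 - a^2) < r)
    (h₂ : r < M + Real.sqrt (M^2 - a^2)) : Δk M a r < 0 := by
  have hsq : a^2 ≤ M^2 := sq_le_sq.2 (haM.le.trans (le_abs_self M))
  have h := Real.sq_sqrt (sub_nonneg.2 hsq)
  unfold Δk
  nlinarith

theorem hasDerivAt_Δk (M a r : ℝ) : HasDerivAt (Δk M a) (2 * (r - M)) r := by
  have h := (((hasDerivAt_id r).pow 2).sub ((hasDerivAt_id r).const_mul (2 * M))).add_const (a^2)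
  refine h.congr_deriv ?_
  simp
  ring

namespace KF

variable {M a : ℝ} {ψ : KF}

theorem SmoothOn.differentiableAt (hψ : ψ.SmoothOn M a) {p : ℝ × ℝ × ℝ × ℝ}
    (hp : p ∈ KerrΩ M a) : DifferentiableAt ℝ ψ.uncurried p :=
  (hψ.contDiffAt ((isOpen_KerrΩ M a).mem_nhds hp)).differentiableAt (by simp)

theorem SmoothOn.hasDerivAt_comp (hψ : ψ.SmoothOn M a) {γ : ℝ → ℝ × ℝ × ℝ × ℝ} {x : ℝ}
    {v : ℝ × ℝ × ℝ × ℝ} (hγ : HasDerivAt γ v x) (hp : γ x ∈ KerrΩ M a) :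
    HasDerivAt (fun y => ψ.uncurried (γ y)) (fderiv ℝ ψ.uncurried (γ x) v) x :=
  (hψ.differentiableAt hp).hasFDerivAt.comp_hasDerivAt x hγ

theorem SmoothOn.hasDerivAt_t_fderiv (hψ : ψ.SmoothOn M a) {t r θ φ : ℝ}
    (hp : (t, r, θ, φ) ∈ KerrΩ M a) :
    HasDerivAt (fun x => ψ x r θ φ) (fderiv ℝ ψ.uncurried (t, r, θ, φ) (1, 0, 0, 0)) t :=
  hψ.hasDerivAt_comp (γ := fun x => (x, r, θ, φ)) ((hasDerivAt_id t).prodMk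
    ((hasDerivAt_const t r).prodMk ((hasDerivAt_const t θ).prodMk (hasDerivAt_const t φ)))) hp

theorem SmoothOn.hasDerivAt_r_fderiv (hψ : ψ.SmoothOn M a) {t r θ φ : ℝ}
    (hp : (t, r, θ, φ) ∈ KerrΩ M a) :
    HasDerivAt (fun x => ψ t x θ φ) (fderiv ℝ ψ.uncurried (t, r, θ, φ) (0, 1, 0, 0)) r :=
  hψ.hasDerivAt_comp (γ := fun x => (t, x, θ, φ)) ((hasDerivAt_const r t).prodMk
    ((hasDerivAt_id r).prodMk ((hasDerivAt_const r θ).prodMk (hasDerivAt_const r φ)))) hp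

theorem SmoothOn.hasDerivAt_φ_fderiv (hψ : ψ.SmoothOn M a) {t r θ φ : ℝ}
    (hp : (t, r, θ, φ) ∈ KerrΩ M a) :
    HasDerivAt (fun x => ψ t r θ x) (fderiv ℝ ψ.uncurried (t, r, θ, φ) (0, 0, 0, 1)) φ :=
  hψ.hasDerivAt_comp (γ := fun x => (t, r, θ, x)) ((hasDerivAt_const φ t).prodMk
    ((hasDerivAt_const φ r).prodMk ((hasDerivAt_const φ θ).prodMk (hasDerivAt_id φ)))) hp

theorem SmoothOn.pt_eqOn (hψ : ψ.SmoothOn M a) :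
    Set.EqOn (pt ψ).uncurried (fun p => fderiv ℝ ψ.uncurried p (1, 0, 0, 0)) (KerrΩ M a) :=
  fun _ hp => (hψ.hasDerivAt_t_fderiv hp).deriv

theorem SmoothOn.pr_eqOn (hψ : ψ.SmoothOn M a) :
    Set.EqOn (pr ψ).uncurried (fun p => fderiv ℝ ψ.uncurried p (0, 1, 0, 0)) (KerrΩ M a) :=
  fun _ hp => (hψ.hasDerivAt_r_fderiv hp).deriv

theorem SmoothOn.pph_eqOn (hψ : ψ.SmoothOn M a) :
    Set.EqOn (pph ψ).uncurried (fun p => fderiv ℝ ψ.uncurried p (0, 0, 0, 1)) (KerrΩ M a) :=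
  fun _ hp => (hψ.hasDerivAt_φ_fderiv hp).deriv

theorem SmoothOn.contDiffOn_fderiv (hψ : ψ.SmoothOn M a) :
    ContDiffOn ℝ (⊤ : ℕ∞) (fderiv ℝ ψ.uncurried) (KerrΩ M a) :=
  hψ.fderiv_of_isOpen (isOpen_KerrΩ M a) (by simp)

theorem SmoothOn.pt (hψ : ψ.SmoothOn M a) : (pt ψ).SmoothOn M a :=
  (hψ.contDiffOn_fderiv.clm_apply contDiffOn_const).congr hψ.pt_eqOn

theorem SmoothOn.pr (hψ : ψ.SmoothOn M a) : (pr ψ).SmoothOn M a :=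
  (hψ.contDiffOn_fderiv.clm_apply contDiffOn_const).congr hψ.pr_eqOn

theorem SmoothOn.pph (hψ : ψ.SmoothOn M a) : (pph ψ).SmoothOn M a :=
  (hψ.contDiffOn_fderiv.clm_apply contDiffOn_const).congr hψ.pph_eqOn

theorem SmoothOn.hasDerivAt_t (hψ : ψ.SmoothOn M a) {t r θ φ : ℝ}
    (hp : (t, r, θ, φ) ∈ KerrΩ M a) :
    HasDerivAt (fun x => ψ x r θ φ) (_root_.pt ψ t r θ φ) t :=
  (hψ.hasDerivAt_t_fderiv hp).differentiableAt.hasDerivAt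

theorem SmoothOn.hasDerivAt_r (hψ : ψ.SmoothOn M a) {t r θ φ : ℝ}
    (hp : (t, r, θ, φ) ∈ KerrΩ M a) :
    HasDerivAt (fun x => ψ t x θ φ) (_root_.pr ψ t r θ φ) r :=
  (hψ.hasDerivAt_r_fderiv hp).differentiableAt.hasDerivAt

theorem SmoothOn.hasDerivAt_φ (hψ : ψ.SmoothOn M a) {t r θ φ : ℝ}
    (hp : (t, r, θ, φ) ∈ KerrΩ M a) :
    HasDerivAt (fun x => ψ t r θ x) (_root_.pph ψ t r θ φ) φ :=
  (hψ.hasDerivAt_φ_fderiv hp).differentiableAt.hasDerivAt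

/-- If `χ` is the derivative of `ψ` in the direction `v`, its derivative in the direction `w`
is a second derivative of `ψ`. -/
theorem SmoothOn.fderiv_of_eqOn (hψ : ψ.SmoothOn M a) {χ : KF} {v : ℝ × ℝ × ℝ × ℝ}
    (hχ : Set.EqOn χ.uncurried (fun p => fderiv ℝ ψ.uncurried p v) (KerrΩ M a))
    {p : ℝ × ℝ × ℝ × ℝ} (hp : p ∈ KerrΩ M a) (w : ℝ × ℝ × ℝ × ℝ) :
    fderiv ℝ χ.uncurried p w = fderiv ℝ (fderiv ℝ ψ.uncurried) p w v := by
  have hΩ := (isOpen_KerrΩ M a).mem_nhds hp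
  have hd : DifferentiableAt ℝ (fderiv ℝ ψ.uncurried) p :=
    (hψ.contDiffOn_fderiv.contDiffAt hΩ).differentiableAt (by simp)
  rw [(hχ.eventuallyEq_of_mem hΩ).fderiv_eq, fderiv_clm_apply hd (differentiableAt_const v)]
  simp

theorem SmoothOn.fderiv_comm (hψ : ψ.SmoothOn M a) {p : ℝ × ℝ × ℝ × ℝ} (hp : p ∈ KerrΩ M a)
    (v w : ℝ × ℝ × ℝ × ℝ) :
    fderiv ℝ (fderiv ℝ ψ.uncurried) p v w = fderiv ℝ (fderiv ℝ ψ.uncurried) p w v :=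
  (hψ.contDiffAt ((isOpen_KerrΩ M a).mem_nhds hp)).isSymmSndFDerivAt
    (by
      rw [minSmoothness_of_isRCLikeNormedField]
      exact WithTop.coe_le_coe.2 le_top) v w

theorem SmoothOn.pr_pt (hψ : ψ.SmoothOn M a) {t r θ φ : ℝ} (hp : (t, r, θ, φ) ∈ KerrΩ M a) :
    _root_.pr (_root_.pt ψ) t r θ φ = _root_.pt (_root_.pr ψ) t r θ φ :=
  calc _ = _ := hψ.pt.pr_eqOn hp
    _ = _ := hψ.fderiv_of_eqOn hψ.pt_eqOn hp _
    _ = _ := hψ.fderiv_comm hp _ _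
    _ = _ := (hψ.fderiv_of_eqOn hψ.pr_eqOn hp _).symm
    _ = _ := (hψ.pr.pt_eqOn hp).symm

theorem SmoothOn.pr_pph (hψ : ψ.SmoothOn M a) {t r θ φ : ℝ} (hp : (t, r, θ, φ) ∈ KerrΩ M a) :
    _root_.pr (_root_.pph ψ) t r θ φ = _root_.pph (_root_.pr ψ) t r θ φ :=
  calc _ = _ := hψ.pph.pr_eqOn hp
    _ = _ := hψ.fderiv_of_eqOn hψ.pph_eqOn hp _
    _ = _ := hψ.fderiv_comm hp _ _
    _ = _ := (hψ.fderiv_of_eqOn hψ.pr_eqOn hp _).symm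
    _ = _ := (hψ.pr.pph_eqOn hp).symm

theorem SmoothOn.pph_pt (hψ : ψ.SmoothOn M a) {t r θ φ : ℝ} (hp : (t, r, θ, φ) ∈ KerrΩ M a) :
    _root_.pph (_root_.pt ψ) t r θ φ = _root_.pt (_root_.pph ψ) t r θ φ :=
  calc _ = _ := hψ.pt.pph_eqOn hp
    _ = _ := hψ.fderiv_of_eqOn hψ.pt_eqOn hp _
    _ = _ := hψ.fderiv_comm hp _ _
    _ = _ := (hψ.fderiv_of_eqOn hψ.pph_eqOn hp _).symm
    _ = _ := (hψ.pph.pt_eqOn hp).symm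

end KF

section RadialWeight

variable (c : ℝ → ℂ) (ψ : KF)

theorem pt_radial_mul :
    pt (fun t r θ φ => c r * ψ t r θ φ) = fun t r θ φ => c r * pt ψ t r θ φ := by
  funext t r θ φ
  exact deriv_const_mul_field _

theorem pph_radial_mul :
    pph (fun t r θ φ => c r * ψ t r θ φ) = fun t r θ φ => c r * pph ψ t r θ φ := by
  funext t r θ φ
  exact deriv_const_mul_field _

theorem pth_radial_mul :
    pth (fun t r θ φ => c r * ψ t r θ φ) = fun t r θ φ => c r * pth ψ t r θ φ := by
  funext t r θ φ
  exact deriv_const_mul_field _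

end RadialWeight

section Expansions

variable {M a : ℝ} {ψ : KF} {t r θ φ : ℝ}

theorem hasDerivAt_Δk_zpow (hΔ : Δk M a r ≠ 0) (n : ℤ) :
    HasDerivAt (fun x => ((Δk M a x ^ n : ℝ) : ℂ))
      ((n : ℂ) * (Δk M a r : ℂ) ^ (n - 1) * (2 * (r - M))) r := by
  have h := ((hasDerivAt_zpow n _ (Or.inl hΔ)).comp r (hasDerivAt_Δk M a r)).ofReal_comp
  refine h.congr_deriv ?_
  push_cast
  ring

/-- The radial part of the Teukolsky operator after conjugation by `Δ ^ s`. -/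
theorem pr_conj_Δk (hψ : ψ.SmoothOn M a) (haM : |a| < M) (hp : (t, r, θ, φ) ∈ KerrΩ M a)
    (s : ℤ) :
    pr (fun t' r' θ' φ' => ((Δk M a r' ^ (s+1) : ℝ) : ℂ) *
        pr (fun t' r' θ' φ' => ((Δk M a r' ^ (-s) : ℝ) : ℂ) * ψ t' r' θ' φ') t' r' θ' φ') t r θ φ
      = (Δk M a r : ℂ) * pr (pr ψ) t r θ φ + (1 - s) * (2 * (r - M)) * pr ψ t r θ φ
        - 2 * s * ψ t r θ φ := by
  have hr : ∀ᶠ x in nhds r, (t, x, θ, φ) ∈ KerrΩ M a := by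
    have hc : Continuous fun x : ℝ => (t, x, θ, φ) := by fun_prop
    exact hc.continuousAt.eventually_mem ((isOpen_KerrΩ M a).mem_nhds hp)
  have hfirst : (fun x => ((Δk M a x ^ (s+1) : ℝ) : ℂ) *
      pr (fun t' r' θ' φ' => ((Δk M a r' ^ (-s) : ℝ) : ℂ) * ψ t' r' θ' φ') t x θ φ)
      =ᶠ[nhds r] fun x => (Δk M a x : ℂ) * pr ψ t x θ φ - s * (2 * (x - M)) * ψ t x θ φ := by
    filter_upwards [hr] with x hx
    have hΔ : Δk M a x ≠ 0 := (Δk_neg haM hx.1 hx.2.1).ne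
    have hΔ' : (Δk M a x : ℂ) ≠ 0 := by exact_mod_cast hΔ
    have h := ((hasDerivAt_Δk_zpow hΔ (-s)).mul (hψ.hasDerivAt_r hx)).deriv
    change _ * deriv (fun y => ((Δk M a y ^ (-s) : ℝ) : ℂ) * ψ t y θ φ) x = _
    refine (congrArg _ h).trans ?_
    have h₁ : (Δk M a x : ℂ) ^ (s+1) * (Δk M a x : ℂ) ^ (-s-1) = 1 := by
      rw [← zpow_add₀ hΔ']; simp
    have h₂ : (Δk M a x : ℂ) ^ (s+1) * (Δk M a x : ℂ) ^ (-s) = Δk M a x := by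
      rw [← zpow_add₀ hΔ']; simp
    push_cast
    linear_combination (-(s : ℂ) * (2 * (x - M)) * ψ t x θ φ) * h₁ + pr ψ t x θ φ * h₂
  refine hfirst.deriv_eq.trans ?_
  have hlin : HasDerivAt (fun x : ℝ => (s : ℂ) * (2 * ((x : ℂ) - M))) (s * (2 * 1)) r :=
    (((hasDerivAt_id r).ofReal_comp.sub_const (M : ℂ)).const_mul 2).const_mul (s : ℂ)
  refine ((((hasDerivAt_Δk M a r).ofReal_comp.mul (hψ.pr.hasDerivAt_r hp)).sub
    (hlin.mul (hψ.hasDerivAt_r hp))).deriv).trans ?_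
  push_cast
  ring

theorem pt_e4 (hψ : ψ.SmoothOn M a) (hp : (t, r, θ, φ) ∈ KerrΩ M a) :
    pt (e4 M a ψ) t r θ φ = (1/2 : ℂ) * (((Δk M a r/(r^2 + a^2) : ℝ) : ℂ) * pt (pr ψ) t r θ φ
      + pt (pt ψ) t r θ φ + ((a/(r^2 + a^2) : ℝ) : ℂ) * pt (pph ψ) t r θ φ) :=
  (((((hψ.pr.hasDerivAt_t hp).const_mul _).add (hψ.pt.hasDerivAt_t hp)).add
    ((hψ.pph.hasDerivAt_t hp).const_mul _)).const_mul _).deriv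

theorem pph_e4 (hψ : ψ.SmoothOn M a) (hp : (t, r, θ, φ) ∈ KerrΩ M a) :
    pph (e4 M a ψ) t r θ φ = (1/2 : ℂ) * (((Δk M a r/(r^2 + a^2) : ℝ) : ℂ) * pph (pr ψ) t r θ φ
      + pt (pph ψ) t r θ φ + ((a/(r^2 + a^2) : ℝ) : ℂ) * pph (pph ψ) t r θ φ) := by
  rw [← hψ.pph_pt hp]
  exact (((((hψ.pr.hasDerivAt_φ hp).const_mul _).add (hψ.pt.hasDerivAt_φ hp)).add
    ((hψ.pph.hasDerivAt_φ hp).const_mul _)).const_mul _).deriv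

theorem pr_e4 (hψ : ψ.SmoothOn M a) (hp : (t, r, θ, φ) ∈ KerrΩ M a) (hR : r^2 + a^2 ≠ 0) :
    pr (e4 M a ψ) t r θ φ = (1/2 : ℂ) *
      ((((2 * (r - M) * (r^2 + a^2) - Δk M a r * (2 * r)) / (r^2 + a^2)^2 : ℝ) : ℂ) * pr ψ t r θ φ
      + ((Δk M a r/(r^2 + a^2) : ℝ) : ℂ) * pr (pr ψ) t r θ φ
      + pt (pr ψ) t r θ φ
      + ((-(a * (2 * r)) / (r^2 + a^2)^2 : ℝ) : ℂ) * pph ψ t r θ φ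
      + ((a/(r^2 + a^2) : ℝ) : ℂ) * pph (pr ψ) t r θ φ) := by
  have hden : HasDerivAt (fun x : ℝ => x^2 + a^2) (2 * r) r := by
    simpa using (hasDerivAt_pow 2 r).add_const (a^2)
  have hμ := ((hasDerivAt_Δk M a r).div hden hR).ofReal_comp
  have hω := ((hasDerivAt_const r a).div hden hR).ofReal_comp
  rw [← hψ.pr_pt hp, ← hψ.pr_pph hp]
  refine ((((hμ.mul (hψ.pr.hasDerivAt_r hp)).add (hψ.pt.hasDerivAt_r hp)).add
    (hω.mul (hψ.pph.hasDerivAt_r hp))).const_mul (1/2 : ℂ)).deriv.trans ?_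
  simp only [Pi.div_apply, zero_mul, zero_sub]
  ring

theorem pt_Uop (hψ : ψ.SmoothOn M a) (hp : (t, r, θ, φ) ∈ KerrΩ M a) (s : ℤ) :
    pt (Uop M a s ψ) t r θ φ = ((1/Real.sin θ : ℝ) : ℂ) * pt (pph ψ) t r θ φ
      + ((a * Real.sin θ : ℝ) : ℂ) * pt (pt ψ) t r θ φ
      + Complex.I * (s : ℂ) *
        (((Real.cos θ/Real.sin θ) * ((r^2 + a^2 * (Real.cos θ)^2)/(r^2 + a^2)) : ℝ) : ℂ) *
        pt ψ t r θ φ :=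
  ((((hψ.pph.hasDerivAt_t hp).const_mul _).add ((hψ.pt.hasDerivAt_t hp).const_mul _)).add
    ((hψ.hasDerivAt_t hp).const_mul _)).deriv

theorem pph_Uop (hψ : ψ.SmoothOn M a) (hp : (t, r, θ, φ) ∈ KerrΩ M a) (s : ℤ) :
    pph (Uop M a s ψ) t r θ φ = ((1/Real.sin θ : ℝ) : ℂ) * pph (pph ψ) t r θ φ
      + ((a * Real.sin θ : ℝ) : ℂ) * pt (pph ψ) t r θ φ
      + Complex.I * (s : ℂ) *
        (((Real.cos θ/Real.sin θ) * ((r^2 + a^2 * (Real.cos θ)^2)/(r^2 + a^2)) : ℝ) : ℂ) *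
        pph ψ t r θ φ := by
  rw [← hψ.pph_pt hp]
  exact ((((hψ.pph.hasDerivAt_φ hp).const_mul _).add ((hψ.pt.hasDerivAt_φ hp).const_mul _)).add
    ((hψ.hasDerivAt_φ hp).const_mul _)).deriv

/-- The rescaled Teukolsky operator with the conjugation by `Δ ^ s` carried out. -/
theorem Teuk_eq (hψ : ψ.SmoothOn M a) (haM : |a| < M) (hp : (t, r, θ, φ) ∈ KerrΩ M a) (s : ℤ) :
    Teuk M a s ψ t r θ φ =
      -((((r^2 + a^2)^2/Δk M a r - a^2 * (Real.sin θ)^2 : ℝ)) : ℂ) * pt (pt ψ) t r θ φ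
      - ((4*M*a*r/Δk M a r : ℝ) : ℂ) * pt (pph ψ) t r θ φ
      - ((a^2/Δk M a r - 1/(Real.sin θ)^2 : ℝ) : ℂ) * pph (pph ψ) t r θ φ
      + ((Δk M a r : ℂ) * pr (pr ψ) t r θ φ + (1 - s) * (2 * (r - M)) * pr ψ t r θ φ
        - 2 * s * ψ t r θ φ)
      + ((1/Real.sin θ : ℝ) : ℂ) *
          pth (fun t' r' θ' φ' => ((Real.sin θ' : ℝ) : ℂ) * pth ψ t' r' θ' φ') t r θ φ
      + 2 * (s : ℂ) * (((a*(r - M)/Δk M a r : ℝ) : ℂ)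
          + Complex.I * ((Real.cos θ/(Real.sin θ)^2 : ℝ) : ℂ)) * pph ψ t r θ φ
      + 2 * (s : ℂ) * (((M*(r^2 - a^2)/Δk M a r - r : ℝ) : ℂ)
          - Complex.I * ((a * Real.cos θ : ℝ) : ℂ)) * pt ψ t r θ φ
      - ((((s : ℝ)^2 * (Real.cos θ)^2/(Real.sin θ)^2 - (s : ℝ) : ℝ)) : ℂ) * ψ t r θ φ := by
  have hΔ : ((Δk M a r : ℝ) : ℂ) ≠ 0 := by exact_mod_cast (Δk_neg haM hp.1 hp.2.1).ne
  have hw : ((Δk M a r ^ s : ℝ) : ℂ) * ((Δk M a r ^ (-s) : ℝ) : ℂ) = 1 := by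
    push_cast
    rw [← zpow_add₀ hΔ]
    simp
  have hθ : (fun t' r' θ' φ' => ((Real.sin θ' : ℝ) : ℂ) *
      pth (fun t' r' θ' φ' => ((Δk M a r' ^ (-s) : ℝ) : ℂ) * ψ t' r' θ' φ') t' r' θ' φ') =
      fun t' r' θ' φ' => ((Δk M a r' ^ (-s) : ℝ) : ℂ) *
        (((Real.sin θ' : ℝ) : ℂ) * pth ψ t' r' θ' φ') := by
    rw [pth_radial_mul (fun x => ((Δk M a x ^ (-s) : ℝ) : ℂ))]
    funext t' r' θ' φ'
    exact mul_left_comm _ _ _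
  unfold Teuk TeukHat
  rw [pr_conj_Δk hψ haM hp, hθ]
  simp only [pt_radial_mul (fun x => ((Δk M a x ^ (-s) : ℝ) : ℂ)),
    pph_radial_mul (fun x => ((Δk M a x ^ (-s) : ℝ) : ℂ)),
    pth_radial_mul (fun x => ((Δk M a x ^ (-s) : ℝ) : ℂ))]
  generalize ((Δk M a r ^ s : ℝ) : ℂ) = w at hw ⊢
  generalize ((Δk M a r ^ (-s) : ℝ) : ℂ) = w' at hw ⊢
  obtain rfl : w' = w⁻¹ := eq_inv_of_mul_eq_one_right hw
  have hw0 : w ≠ 0 := left_ne_zero_of_mul_eq_one hw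
  simp only [mul_add, sub_eq_add_neg]
  field_simp

end Expansions

/-- **Proposition (expression of `𝐓_s` in terms of `e₃`, `e₄`, `𝒰`).** -/
theorem stmt_1 (M a : ℝ) (ha : 0 < |a|) (haM : |a| < M) (s : ℤ) (ψ : KF)
    (hψ : ContDiffOn ℝ (⊤ : ℕ∞) (fun p : ℝ × ℝ × ℝ × ℝ => ψ p.1 p.2.1 p.2.2.1 p.2.2.2) (KerrΩ M a)) :
    ∀ t r θ φ : ℝ,
      M - Real.sqrt (M^2 - a^2) < r → r < M + Real.sqrt (M^2 - a^2) →
      0 < θ → θ < Real.pi →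
      Teuk M a s ψ t r θ φ =
        (-4) * ((r^2 + a^2 : ℝ) : ℂ) * e3 M a (e4 M a ψ) t r θ φ
        + Uop M a s (Uop M a s ψ) t r θ φ
        + ((1/Real.sin θ : ℝ) : ℂ) *
            pth (fun t' r' θ' φ' => ((Real.sin θ' : ℝ) : ℂ) * pth ψ t' r' θ' φ') t r θ φ
        - 4 * Complex.I * (a : ℂ) * (s : ℂ) * ((Real.cos θ : ℝ) : ℂ) * pt ψ t r θ φ
        + 2 * Complex.I * (s : ℂ) *
            ((a^2 * Real.sin θ * Real.cos θ/(r^2 + a^2) : ℝ) : ℂ) * Uop M a s ψ t r θ φ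
        + 2 * (r : ℂ) * (e4 M a ψ t r θ φ
            - ((Δk M a r/(r^2 + a^2) : ℝ) : ℂ) * e3 M a ψ t r θ φ)
        + 4 * (s : ℂ) * (((r - M : ℝ) : ℂ) * e3 M a ψ t r θ φ - (r : ℂ) * pt ψ t r θ φ)
        + ((2*a*r/(r^2 + a^2) : ℝ) : ℂ) * pph ψ t r θ φ
        - (s : ℂ) * ψ t r θ φ
        - (s : ℂ)^2 * ((a^4 * (Real.sin θ)^2 * (Real.cos θ)^2/(r^2 + a^2)^2 : ℝ) : ℂ) *
            ψ t r θ φ := by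
  intro t r θ φ h₁ h₂ h₃ h₄
  have hs : ψ.SmoothOn M a := hψ
  have hp : (t, r, θ, φ) ∈ KerrΩ M a := ⟨h₁, h₂, h₃, h₄⟩
  have hR : r^2 + a^2 ≠ 0 := by
    have := abs_pos.1 ha
    positivity
  have hRc : (r : ℂ)^2 + (a : ℂ)^2 ≠ 0 := by exact_mod_cast hR
  have hΔ : (Δk M a r : ℂ) ≠ 0 := by exact_mod_cast (Δk_neg haM h₁ h₂).ne
  have hΔdef : (Δk M a r : ℂ) = (r : ℂ)^2 - 2 * M * r + (a : ℂ)^2 := by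
    unfold Δk
    push_cast
    ring
  have hsin : (Real.sin θ : ℂ) ≠ 0 := by exact_mod_cast (Real.sin_pos_of_pos_of_lt_pi h₃ h₄).ne'
  have hcos : (Real.cos θ : ℂ)^2 = 1 - (Real.sin θ : ℂ)^2 := by
    exact_mod_cast Real.cos_sq' θ
  rw [Teuk_eq hs haM hp]
  rw [e3, Uop, pt_e4 hs hp, pph_e4 hs hp, pr_e4 hs hp hR, pt_Uop hs hp, pph_Uop hs hp]
  unfold e3 e4 Uop
  simp only [Complex.ofReal_div, Complex.ofReal_mul, Complex.ofReal_add, Complex.ofReal_sub,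
    Complex.ofReal_pow, Complex.ofReal_neg, Complex.ofReal_one, Complex.ofReal_ofNat,
    Complex.ofReal_intCast]
  generalize (Real.cos θ : ℂ) = C at *
  generalize (Real.sin θ : ℂ) = S at *
  generalize (Δk M a r : ℂ) = D at *
  have hI : Complex.I^2 = -1 := Complex.I_sq
  have hpp : -((a : ℂ)^2 / D - 1 / S^2) = -4 * ((r : ℂ)^2 + (a : ℂ)^2) * (1/2) * (a / D) * (1/2)
      * (a / ((r : ℂ)^2 + (a : ℂ)^2)) + 1 / S * (1 / S) := by
    field_simp
    ring
  have htt : -(((r : ℂ)^2 + (a : ℂ)^2)^2 / D - (a : ℂ)^2 * S^2) =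
      -4 * ((r : ℂ)^2 + (a : ℂ)^2) * (1/2) * (((r : ℂ)^2 + (a : ℂ)^2) / D) * (1/2)
      + a * S * (a * S) := by
    ring
  have htp : -(4 * M * a * r / D : ℂ) = -4 * ((r : ℂ)^2 + (a : ℂ)^2) * (1/2) *
      (((r : ℂ)^2 + (a : ℂ)^2) / D * (1/2) * (a / ((r : ℂ)^2 + (a : ℂ)^2)) + a / D * (1/2))
      + 2 * (1 / S) * (a * S) := by
    field_simp
    linear_combination (-8 * a : ℂ) * hΔdef
  have hrr : D = -4 * ((r : ℂ)^2 + (a : ℂ)^2) * (1/2) *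
      (-((1/2) * (D / ((r : ℂ)^2 + (a : ℂ)^2)))) := by
    field_simp
    norm_num
  have hrt : (0 : ℂ) = -4 * ((r : ℂ)^2 + (a : ℂ)^2) * (1/2) *
      (-(1/2) + ((r : ℂ)^2 + (a : ℂ)^2) / D * (1/2) * (D / ((r : ℂ)^2 + (a : ℂ)^2))) := by
    field_simp
    ring
  have hrp : (0 : ℂ) = -4 * ((r : ℂ)^2 + (a : ℂ)^2) * (1/2) *
      (-(1/2) * (a / ((r : ℂ)^2 + (a : ℂ)^2))
        + a / D * (1/2) * (D / ((r : ℂ)^2 + (a : ℂ)^2))) := by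
    field_simp
    ring
  have hr : (1 - (s : ℂ)) * (2 * (r - M)) = -4 * ((r : ℂ)^2 + (a : ℂ)^2) * (1/2) *
      (-((1/2) * ((2 * (r - M) * ((r : ℂ)^2 + (a : ℂ)^2) - D * (2 * r))
        / ((r : ℂ)^2 + (a : ℂ)^2)^2)))
      + 2 * r * ((1/2) * (D / ((r : ℂ)^2 + (a : ℂ)^2))
        - D / ((r : ℂ)^2 + (a : ℂ)^2) * ((1/2) * (-1)))
      + 4 * s * ((r - M) * ((1/2) * (-1))) := by
    field_simp
    ring
  have ht : 2 * (s : ℂ) * (M * ((r : ℂ)^2 - (a : ℂ)^2) / D - r - Complex.I * (a * C)) =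
      2 * (a * S) * (Complex.I * s *
        (C / S * (((r : ℂ)^2 + (a : ℂ)^2 * C^2) / ((r : ℂ)^2 + (a : ℂ)^2))))
      - 4 * Complex.I * a * s * C
      + 2 * Complex.I * s * ((a : ℂ)^2 * S * C / ((r : ℂ)^2 + (a : ℂ)^2)) * (a * S)
      + 2 * r * ((1/2) - D / ((r : ℂ)^2 + (a : ℂ)^2) * ((1/2) * (((r : ℂ)^2 + (a : ℂ)^2) / D)))
      + 4 * s * ((r - M) * ((1/2) * (((r : ℂ)^2 + (a : ℂ)^2) / D)) - r) := by
    field_simp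
    linear_combination (4 * s * (r^2 + a^2) * r : ℂ) * hΔdef
      - 4 * D * s * a^3 * Complex.I * C * hcos
  have hph : 2 * (s : ℂ) * (a * (r - M) / D + Complex.I * (C / S^2)) =
      -4 * ((r : ℂ)^2 + (a : ℂ)^2) * (1/2) *
        (-((1/2) * (-(a * (2 * r)) / ((r : ℂ)^2 + (a : ℂ)^2)^2)))
      + 2 * (1 / S) * (Complex.I * s *
        (C / S * (((r : ℂ)^2 + (a : ℂ)^2 * C^2) / ((r : ℂ)^2 + (a : ℂ)^2))))
      + 2 * Complex.I * s * ((a : ℂ)^2 * S * C / ((r : ℂ)^2 + (a : ℂ)^2)) * (1 / S)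
      + 2 * r * ((1/2) * (a / ((r : ℂ)^2 + (a : ℂ)^2))
        - D / ((r : ℂ)^2 + (a : ℂ)^2) * ((1/2) * (a / D)))
      + 4 * s * ((r - M) * ((1/2) * (a / D)))
      + 2 * a * r / ((r : ℂ)^2 + (a : ℂ)^2) := by
    field_simp
    linear_combination -(4 * s * D * Complex.I * C * a^2 : ℂ) * hcos
  have h0 : -2 * (s : ℂ) - ((s : ℂ)^2 * C^2 / S^2 - s) =
      (Complex.I * s * (C / S * (((r : ℂ)^2 + (a : ℂ)^2 * C^2) / ((r : ℂ)^2 + (a : ℂ)^2))))^2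
      + 2 * Complex.I * s * ((a : ℂ)^2 * S * C / ((r : ℂ)^2 + (a : ℂ)^2)) *
        (Complex.I * s * (C / S * (((r : ℂ)^2 + (a : ℂ)^2 * C^2) / ((r : ℂ)^2 + (a : ℂ)^2))))
      - s - (s : ℂ)^2 * ((a : ℂ)^4 * S^2 * C^2 / ((r : ℂ)^2 + (a : ℂ)^2)^2) := by
    field_simp
    linear_combination ((s : ℂ)^2 * C^2 * a^2 * (2 * r^2 + a^2 * C^2 + S^2 * a^2 + a^2)) * hcos
      - (s : ℂ)^2 * C^2 * (r^2 + C^2 * a^2) * (r^2 + C^2 * a^2 + 2 * S^2 * a^2) * hI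
  linear_combination pph (pph ψ) t r θ φ * hpp + pt (pt ψ) t r θ φ * htt
    + pt (pph ψ) t r θ φ * htp + pr (pr ψ) t r θ φ * hrr + pt (pr ψ) t r θ φ * hrt
    + pph (pr ψ) t r θ φ * hrp + pr ψ t r θ φ * hr + pt ψ t r θ φ * ht
    + pph ψ t r θ φ * hph + ψ t r θ φ * h0
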